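/- arXiv:2402.13370 — 2 statements merged into one kernel-verified Lean document; each statement's English description precedes it below -/
import Mathlib

section
/- Fix a real parameter α ≠ 0, set a(θ) = 4 + α² − 2·cos θ for θ ∈ ℂ, set φ⁻ = 1 + α²/2 and κ = log(φ⁻ + √((φ⁻)² − 1)). Then for every θ ∈ ℂ with |Im θ| < κ, the real part of a(θ) satisfies Re(a(θ)) > 2. -/
open Complex

/-- For `α ≠ 0`, with `a(θ) = 4 + α² - 2 cos θ`, `φ⁻ = 1 + α²/2` and
`κ = log(φ⁻ + √((φ⁻)² - 1))`, every complex `θ` with `|Im θ| < κ` satisfies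
`Re(a(θ)) > 2`. -/
theorem re_a_gt_two_in_strip (α : ℝ) (hα : α ≠ 0) (φm κ : ℝ)
    (hφ : φm = 1 + α ^ 2 / 2)
    (hκ : κ = Real.log (φm + Real.sqrt (φm ^ 2 - 1))) :
    ∀ θ : ℂ, |θ.im| < κ →
      2 < (4 + (α : ℂ) ^ 2 - 2 * Complex.cos θ).re := by
  intro θ hθ
  have h_one_le : 1 ≤ φm := by rw [hφ]; linarith [sq_nonneg α]
  have h_cosh : Real.cosh θ.im < φm := by
    rw [← Real.cosh_arcosh h_one_le, Real.cosh_lt_cosh, Real.arcosh, ← hκ]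
    exact hθ.trans_le (le_abs_self κ)
  have h_cos_re : (Complex.cos θ).re = Real.cos θ.re * Real.cosh θ.im := by
    rw [Complex.cos_eq]
    simp [← ofReal_cos, ← ofReal_cosh, ← ofReal_sin, ← ofReal_sinh]
  have h_re : (4 + (α : ℂ) ^ 2 - 2 * Complex.cos θ).re =
      4 + α ^ 2 - 2 * (Real.cos θ.re * Real.cosh θ.im) := by
    simp [← h_cos_re, ← ofReal_pow]
  have h_mul : Real.cos θ.re * Real.cosh θ.im ≤ Real.cosh θ.im :=
    mul_le_of_le_one_left (Real.cosh_pos _).le (Real.cos_le_one _)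
  rw [h_re]
  linarith
end

section
/- Fix a real parameter α ≠ 0 and integers n, m. For complex θ set a(θ) = 4 + α² − 2·cos θ, K(θ) = (a(θ) + √(a(θ)² − 4))/2 with √ the principal branch of the complex square root, φ⁻ = 1 + α²/2, κ = log(φ⁻ + √((φ⁻)² − 1)), and v(θ) = (1 − e^{iθm}/K(θ)^{|n|})·(K(θ) − 1/K(θ))⁻¹. Then v is holomorphic on the open strip {θ ∈ ℂ : |Im θ| < κ}. -/
open Complex

noncomputable def aFun (α : ℝ) (θ : ℂ) : ℂ := 4 + (α : ℂ) ^ 2 - 2 * Complex.cos θ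

noncomputable def KFun (α : ℝ) (θ : ℂ) : ℂ :=
  (aFun α θ + (aFun α θ ^ 2 - 4) ^ ((1 : ℂ) / 2)) / 2

noncomputable def kappaFun (α : ℝ) : ℝ :=
  Real.log ((1 + α ^ 2 / 2) + Real.sqrt ((1 + α ^ 2 / 2) ^ 2 - 1))

noncomputable def vFun (α : ℝ) (n m : ℤ) (θ : ℂ) : ℂ :=
  (1 - Complex.exp (Complex.I * θ * (m : ℂ)) / KFun α θ ^ n.natAbs) *
    (KFun α θ - 1 / KFun α θ)⁻¹

theorem cosh_kappaFun (α : ℝ) : Real.cosh (kappaFun α) = 1 + α ^ 2 / 2 := by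
  have hφ : 1 ≤ 1 + α ^ 2 / 2 := by nlinarith [sq_nonneg α]
  exact Real.cosh_arcosh hφ

theorem kappaFun_nonneg (α : ℝ) : 0 ≤ kappaFun α := by
  have hφ : 1 ≤ 1 + α ^ 2 / 2 := by nlinarith [sq_nonneg α]
  exact Real.arcosh_nonneg hφ

theorem two_lt_re_aFun {α : ℝ} {θ : ℂ} (hθ : |θ.im| < kappaFun α) : 2 < (aFun α θ).re := by
  have hcosh : Real.cosh θ.im < 1 + α ^ 2 / 2 := by
    rw [← cosh_kappaFun, Real.cosh_lt_cosh, abs_of_nonneg (kappaFun_nonneg α)]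
    exact hθ
  have hre : (aFun α θ).re = 4 + α ^ 2 - 2 * (Real.cos θ.re * Real.cosh θ.im) := by
    have hcos : (Complex.cos θ).re = Real.cos θ.re * Real.cosh θ.im := by
      rw [Complex.cos_eq, ← ofReal_cos, ← ofReal_cosh, ← ofReal_sin, ← ofReal_sinh]
      simp [-ofReal_cos, -ofReal_cosh, -ofReal_sin, -ofReal_sinh]
    simp [aFun, hcos, ← ofReal_pow]
  rw [hre]
  nlinarith [Real.cos_le_one θ.re, Real.cosh_pos θ.im]

theorem sq_sub_four_mem_slitPlane {a : ℂ} (ha : 2 < a.re) : a ^ 2 - 4 ∈ slitPlane := by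
  rw [mem_slitPlane_iff]
  by_cases him : a.im = 0
  · left
    simp [pow_two, him]
    nlinarith
  · right
    simp only [pow_two, sub_im, mul_im, im_ofNat, sub_zero]
    intro h
    have : a.re * a.im = 0 := by linarith
    rcases mul_eq_zero.mp this with h | h
    · linarith
    · exact him h

theorem differentiableOn_KFun (α : ℝ) :
    DifferentiableOn ℂ (KFun α) {θ : ℂ | |θ.im| < kappaFun α} := by
  intro θ hθ
  have hslit := sq_sub_four_mem_slitPlane (two_lt_re_aFun hθ)
  have ha : DifferentiableAt ℂ (aFun α) θ := by
    unfold aFun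
    fun_prop
  have hs : DifferentiableAt ℂ (fun z => (aFun α z ^ 2 - 4) ^ ((1 : ℂ) / 2)) θ :=
    ((ha.pow 2).sub_const 4).cpow (differentiableAt_const _) hslit
  exact ((ha.add hs).div_const 2).differentiableWithinAt

theorem KFun_mul_conjugate (α : ℝ) (θ : ℂ) :
    KFun α θ * ((aFun α θ - (aFun α θ ^ 2 - 4) ^ ((1 : ℂ) / 2)) / 2) = 1 := by
  have hs : ((aFun α θ ^ 2 - 4) ^ ((1 : ℂ) / 2)) ^ 2 = aFun α θ ^ 2 - 4 := by
    rw [one_div]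
    exact cpow_nat_inv_pow _ two_ne_zero
  unfold KFun
  linear_combination -hs / 4

theorem KFun_ne_zero (α : ℝ) (θ : ℂ) : KFun α θ ≠ 0 :=
  left_ne_zero_of_mul_eq_one (KFun_mul_conjugate α θ)

theorem KFun_sub_inv (α : ℝ) (θ : ℂ) :
    KFun α θ - 1 / KFun α θ = (aFun α θ ^ 2 - 4) ^ ((1 : ℂ) / 2) := by
  rw [one_div, inv_eq_of_mul_eq_one_right (KFun_mul_conjugate α θ), KFun]
  ring

/-- The integrand `v` of the screened-Poisson LGF is holomorphic on the strip
`{θ : |Im θ| < κ}`. -/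
theorem vFun_differentiableOn_strip (α : ℝ) (hα : α ≠ 0) (n m : ℤ) :
    DifferentiableOn ℂ (vFun α n m) {θ : ℂ | |θ.im| < kappaFun α} := by
  have hK := differentiableOn_KFun α
  have hK0 : ∀ θ ∈ {θ : ℂ | |θ.im| < kappaFun α}, KFun α θ ≠ 0 := fun θ _ => KFun_ne_zero α θ
  have hexp : DifferentiableOn ℂ (fun θ : ℂ => exp (I * θ * (m : ℂ)))
      {θ : ℂ | |θ.im| < kappaFun α} := by fun_prop
  refine ((hexp.div (hK.pow n.natAbs) fun θ hθ => pow_ne_zero _ (hK0 θ hθ)).const_sub 1).mul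
    ((hK.sub ((differentiableOn_const 1).div hK hK0)).inv fun θ hθ => ?_)
  have hslit := sq_sub_four_mem_slitPlane (two_lt_re_aFun hθ)
  change KFun α θ - 1 / KFun α θ ≠ 0
  rw [KFun_sub_inv]
  exact fun h => slitPlane_ne_zero hslit ((cpow_eq_zero_iff _ _).mp h).1
end
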